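/- arXiv:2203.01354 — 4 statements merged into one kernel-verified Lean document; each statement's English description precedes it below -/
import Mathlib

section
/- For every integer k ≥ 2 and each choice of sign ±, there exists a group homomorphism ρ^±_q̂ from the symmetric group S_k to the group of invertible K-linear operators on V^{⊗k} such that ρ^±_q̂(σ_a) = ±P_q̂^{(a,a+1)} for every adjacent transposition σ_a = (a, a+1), a = 1, …, k−1. -/
open scoped BigOperators

noncomputable section

/-- A parameter matrix: nonzero scalars `q i j` in a field `K` of characteristic `0`
with `q i j = (q j i)⁻¹` and `q i i = 1` for all `i j` in a finite index set `N`. -/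
structure ParamMatrix (K : Type*) (N : Type*) [Field K] where
  q : N → N → K
  q_ne : ∀ i j, q i j ≠ 0
  q_symm : ∀ i j, q i j = (q j i)⁻¹
  q_diag : ∀ i, q i i = 1

variable {K : Type*} [Field K] [CharZero K] {N : Type*} [Fintype N] [DecidableEq N]

/-- The q̂-permutation operator on `V ⊗ V`, where `V = N → K` and `V ⊗ V` is realized as
`(N × N) → K` with basis vector `e l ⊗ e m = Pi.single (l, m) 1`.  It sends
`e l ⊗ e m ↦ q l m • (e m ⊗ e l)`. -/
def permOp (qh : ParamMatrix K N) : Module.End K (N × N → K) where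
  toFun f := fun p => qh.q p.2 p.1 * f (p.2, p.1)
  map_add' f g := by funext p; simp [mul_add]
  map_smul' c f := by funext p; simp [smul_eq_mul]; ring

/-- The operator `T^{(a,b)}` on `V^{⊗k} = (Fin k → N) → K` (for `a ≠ b`): it acts as `T` on
the `a`-th and `b`-th tensor factors and as the identity on all other factors. -/
def liftAB {k : ℕ} (T : Module.End K (N × N → K)) (a b : Fin k) :
    Module.End K ((Fin k → N) → K) where
  toFun f := fun v => ∑ l : N, ∑ m : N,
    T (Pi.single (l, m) 1) (v a, v b) * f (Function.update (Function.update v a l) b m)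
  map_add' f g := by
    funext v
    simp [mul_add, Finset.sum_add_distrib]
  map_smul' c f := by
    funext v
    simp only [Pi.smul_apply, smul_eq_mul, RingHom.id_apply, Finset.mul_sum]
    congr 1; funext l; congr 1; funext m; ring

/-- An antisymmetric (in the multiplicative sense) parameter matrix is a quotient
`s i j / s j i`. -/
lemma ParamMatrix.exists_factor {K N : Type*} [Field K] (qh : ParamMatrix K N) :
    ∃ s : N → N → K, (∀ i j, s i j ≠ 0) ∧ ∀ i j, s i j = qh.q i j * s j i := by
  classical
  let _ : LinearOrder N := WellOrderingRel.isWellOrder.linearOrder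
  refine ⟨fun i j => if i < j then qh.q i j else 1, fun i j => ?_, fun i j => ?_⟩
  · dsimp only
    split_ifs
    exacts [qh.q_ne i j, one_ne_zero]
  · rcases lt_trichotomy i j with h | rfl | h
    · simp [h, h.not_gt]
    · simp [qh.q_diag]
    · simp [h, h.not_gt, qh.q_symm i j, qh.q_ne j i]

/-- The product of `s (v i) (v j)` over all pairs of positions `i < j`. -/
def pairProd {K N : Type*} [CommMonoid K] {k : ℕ} (s : N → N → K) (v : Fin k → N) : K :=
  ∏ p : Fin k × Fin k with p.1 < p.2, s (v p.1) (v p.2)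

lemma pairProd_comp_swap {K N : Type*} [CommMonoid K] {k : ℕ} (s : N → N → K)
    (v : Fin k → N) {a b : Fin k} (hab : (a : ℕ) + 1 = b) :
    pairProd s (v ∘ Equiv.swap a b) * s (v a) (v b) = pairProd s v * s (v b) (v a) := by
  have hmem : (a, b) ∈ ({p | p.1 < p.2} : Finset (Fin k × Fin k)) := by
    simpa using Fin.lt_def.2 (by omega)
  have herase :
      ∏ p ∈ ({p | p.1 < p.2} : Finset (Fin k × Fin k)).erase (a, b),
        s ((v ∘ Equiv.swap a b) p.1) ((v ∘ Equiv.swap a b) p.2) =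
      ∏ p ∈ ({p | p.1 < p.2} : Finset (Fin k × Fin k)).erase (a, b), s (v p.1) (v p.2) := by
    refine Finset.prod_equiv ((Equiv.swap a b).prodCongr (Equiv.swap a b)) ?_ (by simp)
    rintro ⟨i, j⟩
    simp only [Finset.mem_erase, Finset.mem_filter, Finset.mem_univ, true_and,
      Equiv.prodCongr_apply, Prod.map_apply, ne_eq, Prod.mk.injEq, Equiv.swap_apply_def,
      Fin.ext_iff, Fin.lt_def]
    split_ifs <;> omega
  unfold pairProd
  rw [← Finset.mul_prod_erase _ _ hmem, herase, ← Finset.mul_prod_erase _ _ hmem]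
  simp only [Function.comp_apply, Equiv.swap_apply_left, Equiv.swap_apply_right]
  rw [mul_right_comm, mul_comm (s (v b) (v a)), mul_right_comm]

lemma pairProd_ne_zero {K N : Type*} [Field K] {k : ℕ} {s : N → N → K}
    (hs : ∀ i j, s i j ≠ 0) (v : Fin k → N) : pairProd s v ≠ 0 :=
  Finset.prod_ne_zero_iff.2 fun _ _ => hs _ _

/-- The permutation action on functions of `v : ι → N`, twisted by a character `χ` and
conjugated by multiplication with a nowhere vanishing function `D`. -/
def twistedPermRep {K N ι : Type*} [Field K] (χ : Equiv.Perm ι →* K) (D : (ι → N) → K)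
    (hD : ∀ v, D v ≠ 0) : Equiv.Perm ι →* Module.End K ((ι → N) → K) where
  toFun σ :=
    { toFun := fun f v => χ σ * ((D v)⁻¹ * D (v ∘ σ)) * f (v ∘ σ)
      map_add' := fun f g => by funext v; simp [mul_add]
      map_smul' := fun c f => by
        funext v
        simp only [Pi.smul_apply, smul_eq_mul, RingHom.id_apply]
        ring }
  map_one' := by
    ext f v
    simp [hD]
  map_mul' σ τ := by
    refine LinearMap.ext fun f => funext fun v => ?_
    have := hD (v ∘ σ)
    simp only [map_mul, LinearMap.coe_mk, AddHom.coe_mk, Module.End.mul_apply,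
      Equiv.Perm.coe_mul, ← Function.comp_assoc]
    field_simp

lemma liftAB_permOp_apply {K N : Type*} [Field K] [Fintype N] [DecidableEq N] {k : ℕ}
    (qh : ParamMatrix K N) {a b : Fin k} (f : (Fin k → N) → K) (v : Fin k → N) :
    liftAB (permOp qh) a b f v = qh.q (v b) (v a) * f (v ∘ Equiv.swap a b) := by
  have hupd : Function.update (Function.update v a (v b)) b (v a) = v ∘ Equiv.swap a b := by
    funext i
    simp only [Function.update_apply, Function.comp_apply, Equiv.swap_apply_def]
    split_ifs <;> simp_all
  have hterm : ∀ l m, permOp qh (Pi.single (l, m) 1) (v a, v b) =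
      if v b = l then if v a = m then qh.q (v b) (v a) else 0 else 0 := by
    intro l m
    simp only [permOp, LinearMap.coe_mk, AddHom.coe_mk, Pi.single_apply, Prod.mk.injEq]
    split_ifs <;> simp_all
  simp only [liftAB, LinearMap.coe_mk, AddHom.coe_mk, hterm]
  simp [ite_mul, hupd]

/-- Every sign `ε = ±1` is the common value on transpositions of a character of the
symmetric group. -/
lemma exists_perm_character {K ι : Type*} [Field K] [Fintype ι] [DecidableEq ι] {ε : K}
    (hε : ε = 1 ∨ ε = -1) :
    ∃ χ : Equiv.Perm ι →* K, ∀ i j, i ≠ j → χ (Equiv.swap i j) = ε := by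
  rcases hε with rfl | rfl
  · exact ⟨1, fun _ _ _ => rfl⟩
  · refine ⟨((Int.castRingHom K : ℤ →* K).comp (Units.coeHom ℤ)).comp Equiv.Perm.sign, ?_⟩
    intro i j hij
    simp [Equiv.Perm.sign_swap hij]

/-- for every `k ≥ 2` and each sign `ε = ±1`, there is a group homomorphism
`ρ` from the symmetric group `S_k` to the group of invertible linear operators on `V^{⊗k}`
with `ρ(σ_a) = ε • P_q̂^{(a,a+1)}` for every adjacent transposition `σ_a`. -/
theorem exists_perm_rep (qh : ParamMatrix K N) (k : ℕ) (hk : 2 ≤ k)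
    (ε : K) (hε : ε = 1 ∨ ε = -1) :
    ∃ ρ : Equiv.Perm (Fin k) →* (Module.End K ((Fin k → N) → K))ˣ,
      ∀ (a : ℕ) (h : a + 1 < k),
        (ρ (Equiv.swap ⟨a, by omega⟩ ⟨a + 1, h⟩) : Module.End K ((Fin k → N) → K))
          = ε • liftAB (permOp qh) ⟨a, by omega⟩ ⟨a + 1, h⟩ := by
  obtain ⟨s, hs, hsq⟩ := qh.exists_factor
  obtain ⟨χ, hχ⟩ := exists_perm_character (ι := Fin k) hε
  refine ⟨(twistedPermRep χ (pairProd s) (pairProd_ne_zero hs)).toHomUnits, fun a h => ?_⟩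
  refine LinearMap.ext fun f => funext fun v => ?_
  set i : Fin k := ⟨a, by omega⟩ with hi
  set j : Fin k := ⟨a + 1, h⟩ with hj
  have hswap : (pairProd s v)⁻¹ * pairProd s (v ∘ Equiv.swap i j) = qh.q (v j) (v i) := by
    rw [inv_mul_eq_iff_eq_mul₀ (pairProd_ne_zero hs v)]
    refine mul_right_cancel₀ (hs (v i) (v j)) ?_
    rw [pairProd_comp_swap s v (a := i) (b := j) rfl, hsq (v j) (v i), mul_assoc]
  rw [LinearMap.smul_apply, Pi.smul_apply, liftAB_permOp_apply, MonoidHom.coe_toHomUnits]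
  simp only [twistedPermRep, MonoidHom.coe_mk, OneHom.coe_mk, LinearMap.coe_mk, AddHom.coe_mk,
    hswap, smul_eq_mul]
  rw [hχ i j (by simp [hi, hj]), mul_assoc]
end
end

section
/- The operators P_q and Q_q satisfy P_q ∘ Q_q = Q_q ∘ P_q = −Q_q on V ⊗ V. -/
open scoped BigOperators

noncomputable section

/-- The index set `I = {-r, …, -1, 1, …, r}` as a subtype of `ℤ`. -/
abbrev SIdx (r : ℕ) : Type := {i : ℤ // i ∈ (Finset.Icc (-(r : ℤ)) (r : ℤ)).erase 0}

instance (r : ℕ) : Neg (SIdx r) :=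
  ⟨fun i => ⟨-i.1, by
    obtain ⟨h1, h2⟩ := Finset.mem_erase.mp i.2
    rw [Finset.mem_Icc] at h2
    exact Finset.mem_erase.mpr ⟨neg_ne_zero.mpr h1, Finset.mem_Icc.mpr (by omega)⟩⟩⟩

/-- The sign `ε_i`: `1` for `i > 0` and `-1` for `i < 0`, as an element of `K`. -/
def sgn (K : Type*) [Field K] {r : ℕ} (i : SIdx r) : K := if 0 < i.1 then 1 else -1

/-- A symplectic parameter family `q = (q_{ij}, q_i)`: nonzero scalars with
`q_{ij} = q_{ji}⁻¹`, `q_{ii} = 1`, `q_{-i} = q_i⁻¹` and `q_{-i,j} = q_{ij}⁻¹ q_j²`. -/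
structure SympParam (K : Type*) [Field K] (r : ℕ) where
  qm : SIdx r → SIdx r → K
  qv : SIdx r → K
  qm_ne : ∀ i j, qm i j ≠ 0
  qv_ne : ∀ i, qv i ≠ 0
  qm_symm : ∀ i j, qm i j = (qm j i)⁻¹
  qm_diag : ∀ i, qm i i = 1
  qv_neg : ∀ i, qv (-i) = (qv i)⁻¹
  qm_neg : ∀ i j, qm (-i) j = (qm i j)⁻¹ * (qv j) ^ 2

variable {K : Type*} [Field K] [CharZero K] {r : ℕ}

/-- The operator `P_q` on `V ⊗ V`, where `V = SIdx r → K` and `V ⊗ V` is realized as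
`(SIdx r × SIdx r) → K` with basis vector `e l ⊗ e m = Pi.single (l, m) 1`.  It sends
`e l ⊗ e m ↦ q_{lm} • (e m ⊗ e l)`. -/
def Pq (q : SympParam K r) : Module.End K (SIdx r × SIdx r → K) where
  toFun f := fun p => q.qm p.2 p.1 * f (p.2, p.1)
  map_add' f g := by funext p; simp [mul_add]
  map_smul' c f := by funext p; simp [smul_eq_mul]; ring

/-- The operator `Q_q` on `V ⊗ V`: it sends
`e l ⊗ e m ↦ δ_{m,-l} ε_l q_l⁻¹ • ∑ i, ε_i q_i • (e i ⊗ e (-i))`. -/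
def Qq (q : SympParam K r) : Module.End K (SIdx r × SIdx r → K) where
  toFun f := fun p =>
    if p.2 = -p.1 then
      sgn K p.1 * q.qv p.1 * ∑ l : SIdx r, sgn K l * (q.qv l)⁻¹ * f (l, -l)
    else 0
  map_add' f g := by
    funext p
    by_cases h : p.2 = -p.1 <;> simp [h, mul_add, Finset.sum_add_distrib]
  map_smul' c f := by
    funext p
    by_cases h : p.2 = -p.1 <;>
      simp only [h, if_true, if_false, Pi.smul_apply, smul_eq_mul, RingHom.id_apply,
        Finset.mul_sum, mul_zero]
    · exact Finset.sum_congr rfl fun l _ => by ring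

theorem SIdx.neg_neg (i : SIdx r) : - -i = i :=
  Subtype.ext (_root_.neg_neg i.1)

theorem SIdx.eq_neg_comm {i j : SIdx r} : i = -j ↔ j = -i :=
  ⟨fun h => by rw [h, SIdx.neg_neg], fun h => by rw [h, SIdx.neg_neg]⟩

theorem sgn_neg {F : Type*} [Field F] (i : SIdx r) : sgn F (-i) = -sgn F i := by
  have hi : i.1 ≠ 0 := (Finset.mem_erase.mp i.2).1
  have hneg : (-i).1 = -i.1 := rfl
  unfold sgn
  rw [hneg]
  rcases lt_or_gt_of_ne hi with h | h
  · rw [if_pos (by omega), if_neg (by omega), _root_.neg_neg]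
  · rw [if_neg (by omega), if_pos h]

theorem SympParam.qm_neg_self {F : Type*} [Field F] (q : SympParam F r) (i : SIdx r) :
    q.qm (-i) i = q.qv i ^ 2 := by
  rw [q.qm_neg, q.qm_diag, inv_one, one_mul]

/-- `P_q ∘ Q_q = Q_q ∘ P_q = −Q_q` on `V ⊗ V`. -/
theorem Pq_comp_Qq (hr : 1 ≤ r) (q : SympParam K r) :
    Pq q ∘ₗ Qq q = -Qq q ∧ Qq q ∘ₗ Pq q = -Qq q := by
  constructor
  · refine LinearMap.ext fun f => funext fun ⟨a, b⟩ => ?_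
    simp only [Pq, Qq, LinearMap.comp_apply, LinearMap.coe_mk, AddHom.coe_mk,
      LinearMap.neg_apply, Pi.neg_apply]
    by_cases h : b = -a
    · subst h
      rw [if_pos (SIdx.neg_neg a).symm, if_pos rfl, q.qm_neg_self, sgn_neg, q.qv_neg]
      have := q.qv_ne a
      field_simp
    · rw [if_neg (mt SIdx.eq_neg_comm.mp h), if_neg h, mul_zero, neg_zero]
  · refine LinearMap.ext fun f => funext fun ⟨a, b⟩ => ?_
    simp only [Pq, Qq, LinearMap.comp_apply, LinearMap.coe_mk, AddHom.coe_mk,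
      LinearMap.neg_apply, Pi.neg_apply]
    split_ifs with h
    · rw [← mul_neg, ← Finset.sum_neg_distrib]
      congr 1
      refine Fintype.sum_bijective (fun l : SIdx r => -l)
        (Function.Involutive.bijective SIdx.neg_neg) _ _ fun l => ?_
      rw [SIdx.neg_neg, q.qm_neg_self, sgn_neg, q.qv_neg]
      have := q.qv_ne l
      field_simp
    · exact neg_zero.symm
end
end

section
/- In the q̂-Grassmann algebra Ξ(q̂) whose parameter matrix comes from a symplectic parameter family, the quadratic elements ψ_i ψ_{−i} pairwise commute: (ψ_i ψ_{−i})(ψ_j ψ_{−j}) = (ψ_j ψ_{−j})(ψ_i ψ_{−i}) for all i, j ∈ I. -/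
open scoped BigOperators

noncomputable section

variable {K : Type*} [Field K] [CharZero K] {r : ℕ}

/-- The relations of the q̂-Grassmann algebra: `ψ_i ψ_j + q_{ij} ψ_j ψ_i = 0`. -/
inductive GrassRel (K : Type*) [Field K] {N : Type*} (qf : N → N → K) :
    FreeAlgebra K N → FreeAlgebra K N → Prop
  | rel (i j : N) : GrassRel K qf
      (FreeAlgebra.ι K i * FreeAlgebra.ι K j + qf i j • (FreeAlgebra.ι K j * FreeAlgebra.ι K i))
      0

/-- The q̂-Grassmann algebra `Ξ(q̂)`: the quotient of the free associative unital `K`-algebra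
on the generators `ψ_i` by the two-sided ideal generated by `ψ_i ψ_j + q_{ij} ψ_j ψ_i`. -/
abbrev Grass (K : Type*) [Field K] {N : Type*} (qf : N → N → K) :=
  RingQuot (GrassRel K qf)

/-- The generator `ψ_i` of the q̂-Grassmann algebra. -/
def psi (K : Type*) [Field K] {N : Type*} (qf : N → N → K) (i : N) : Grass K qf :=
  RingQuot.mkAlgHom K (GrassRel K qf) (FreeAlgebra.ι K i)

/-- The defining relation of the q̂-Grassmann algebra. -/
theorem psi_mul_psi {F N : Type*} [Field F] (qf : N → N → F) (i j : N) :
    psi F qf i * psi F qf j = (-qf i j) • (psi F qf j * psi F qf i) := by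
  have h : psi F qf i * psi F qf j + qf i j • (psi F qf j * psi F qf i) = 0 := by
    simpa only [psi, map_add, map_mul, map_smul, map_zero] using
      RingQuot.mkAlgHom_rel F (GrassRel.rel (K := F) (qf := qf) i j)
  calc psi F qf i * psi F qf j
      = psi F qf i * psi F qf j + (qf i j + -qf i j) • (psi F qf j * psi F qf i) := by
        rw [add_neg_cancel, zero_smul, add_zero]
    _ = (-qf i j) • (psi F qf j * psi F qf i) := by rw [add_smul, ← add_assoc, h, zero_add]

/-- Moving a generator past a product of two generators. -/
theorem psi_mul_psi_mul_psi {F N : Type*} [Field F] (qf : N → N → F) (i k j : N) :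
    psi F qf i * psi F qf k * psi F qf j
      = (qf i j * qf k j) • (psi F qf j * (psi F qf i * psi F qf k)) := by
  rw [mul_assoc, psi_mul_psi qf k j, mul_smul_comm, ← mul_assoc, psi_mul_psi qf i j,
    smul_mul_assoc, smul_smul, mul_assoc, neg_mul_neg, mul_comm (qf i j)]

/-- The pair `ψ_i ψ_{-i}` commutes with `ψ_j` up to the factor `q_j²`, independent of `i`. -/
theorem psi_pair_mul_psi {F : Type*} [Field F] {n : ℕ} (q : SympParam F n) (i j : SIdx n) :
    psi F q.qm i * psi F q.qm (-i) * psi F q.qm j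
      = q.qv j ^ 2 • (psi F q.qm j * (psi F q.qm i * psi F q.qm (-i))) := by
  rw [psi_mul_psi_mul_psi, q.qm_neg, mul_inv_cancel_left₀ (q.qm_ne i j)]

/-- in the q̂-Grassmann algebra whose parameter matrix comes from a symplectic
parameter family, the quadratic elements `ψ_i ψ_{−i}` pairwise commute. -/
theorem psi_pair_comm (hr : 1 ≤ r) (q : SympParam K r) (i j : SIdx r) :
    psi K q.qm i * psi K q.qm (-i) * (psi K q.qm j * psi K q.qm (-j))
      = psi K q.qm j * psi K q.qm (-j) * (psi K q.qm i * psi K q.qm (-i)) := by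
  rw [← mul_assoc, psi_pair_mul_psi, smul_mul_assoc, mul_assoc, psi_pair_mul_psi, mul_smul_comm,
    smul_smul, q.qv_neg, ← mul_pow, mul_inv_cancel₀ (q.qv_ne j), one_pow, one_smul, mul_assoc]
end
end

section
/- Let k ≥ 1 and let ρ : S_k → GL(V^{⊗k}) be the group homomorphism with ρ(σ_a) = −P_q̂^{(a,a+1)} for every adjacent transposition σ_a, a = 1, …, k−1, and set A_{q̂,(k)} = (1/k!) Σ_{σ∈S_k} ρ(σ). Then for every k-tuple I = (i_1, …, i_k) of pairwise distinct indices and every σ ∈ S_k, the coefficient of e_{i_{σ(1)}} ⊗ ⋯ ⊗ e_{i_{σ(k)}} in A_{q̂,(k)}(e_{i_1} ⊗ ⋯ ⊗ e_{i_k}) equals (1/k!) · (−1)^σ · μ_I(q̂, σ), where (−1)^σ is the sign of σ. -/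
open scoped BigOperators

noncomputable section

variable {K : Type*} [Field K] [CharZero K] {N : Type*} [Fintype N] [DecidableEq N]

/-- `μ_I(q̂, σ) = ∏_{s < t, σ⁻¹(s) > σ⁻¹(t)} q_{i_s i_t}`. -/
def muI (qh : ParamMatrix K N) {k : ℕ} (I : Fin k → N) (σ : Equiv.Perm (Fin k)) : K :=
  ∏ p ∈ Finset.univ.filter
      (fun p : Fin k × Fin k => p.1 < p.2 ∧ σ⁻¹ p.2 < σ⁻¹ p.1),
    qh.q (I p.1) (I p.2)

/-- `P_q̂^{(a,b)}` sends the basis tensor `e_v` to `q_{v_a v_b}` times the basis tensor with the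
`a`-th and `b`-th factors exchanged. -/
theorem liftAB_permOp_single {F ι : Type*} [Field F] [Fintype ι] [DecidableEq ι]
    (qh : ParamMatrix F ι) {k : ℕ} {a b : Fin k} (hab : a ≠ b)
    (v : Fin k → ι) :
    liftAB (permOp qh) a b (Pi.single v 1)
      = qh.q (v a) (v b) • Pi.single (v ∘ Equiv.swap a b) (1 : F) := by
  funext w
  have hupd : Function.update (Function.update w a (w b)) b (w a) = w ∘ Equiv.swap a b := by
    funext x
    by_cases hb : x = b
    · simp [hb]
    · by_cases ha : x = a
      · simp [ha, hab]
      · simp [ha, hb, Equiv.swap_apply_of_ne_of_ne]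
  have hcoeff (l m : ι) : permOp qh (Pi.single (l, m) 1) (w a, w b)
      = if l = w b then (if m = w a then qh.q (w b) (w a) else 0) else 0 := by
    simp only [permOp, LinearMap.coe_mk, AddHom.coe_mk, Pi.single_apply, Prod.mk.injEq]
    grind
  have hiff : w ∘ Equiv.swap a b = v ↔ w = v ∘ Equiv.swap a b := by
    constructor <;> rintro rfl <;> funext x <;> simp
  simp only [liftAB, LinearMap.coe_mk, AddHom.coe_mk, hcoeff, ite_mul, zero_mul,
    Finset.sum_ite_eq', Finset.mem_univ, if_true, Finset.sum_ite_irrel, Finset.sum_const_zero,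
    hupd, Pi.smul_apply, smul_eq_mul, Pi.single_apply, hiff]
  split_ifs with h
  · subst h; simp
  · simp

/-- Exchanging two adjacent positions preserves the order of every other pair of positions. -/
theorem swap_castSucc_succ_lt_iff {n : ℕ} (i : Fin n) {x y : Fin (n + 1)}
    (h₁ : ¬(x = i.castSucc ∧ y = i.succ)) (h₂ : ¬(x = i.succ ∧ y = i.castSucc)) :
    Equiv.swap i.castSucc i.succ y < Equiv.swap i.castSucc i.succ x ↔ y < x := by
  simp only [Fin.ext_iff, Fin.val_castSucc, Fin.val_succ] at h₁ h₂
  simp only [Equiv.swap_apply_def, Fin.ext_iff, Fin.val_castSucc, Fin.val_succ]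
  split_ifs <;> simp only [Fin.lt_def, Fin.val_castSucc, Fin.val_succ] <;> omega

/-- `μ_I` gains one factor under an adjacent transposition that creates an inversion. -/
theorem muI_mul_swap_of_lt {F ι : Type*} [Field F]
    (qh : ParamMatrix F ι) {n : ℕ} (I : Fin (n + 1) → ι)
    (σ : Equiv.Perm (Fin (n + 1))) (i : Fin n) (h : σ i.castSucc < σ i.succ) :
    muI qh I (σ * Equiv.swap i.castSucc i.succ)
      = qh.q (I (σ i.castSucc)) (I (σ i.succ)) * muI qh I σ := by
  unfold muI
  rw [← Finset.prod_insert (a := (σ i.castSucc, σ i.succ))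
    (f := fun p => qh.q (I p.1) (I p.2))]
  · congr 1
    ext ⟨x, y⟩
    obtain ⟨x, rfl⟩ := σ.surjective x
    obtain ⟨y, rfl⟩ := σ.surjective y
    simp only [Finset.mem_filter, Finset.mem_univ, true_and, Finset.mem_insert, Prod.mk.injEq,
      mul_inv_rev, Equiv.swap_inv, Equiv.Perm.mul_apply, Equiv.Perm.coe_inv, Equiv.symm_apply_apply,
      EmbeddingLike.apply_eq_iff_eq]
    by_cases h₁ : x = i.castSucc ∧ y = i.succ
    · obtain ⟨rfl, rfl⟩ := h₁
      simp [h]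
    by_cases h₂ : x = i.succ ∧ y = i.castSucc
    · obtain ⟨rfl, rfl⟩ := h₂
      simp [h.not_gt, Fin.ext_iff]
    rw [swap_castSucc_succ_lt_iff i h₁ h₂]
    simp [h₁]
  · simp [Fin.le_def]

/-- The recursion of `μ_I` under right multiplication by an adjacent transposition. -/
theorem muI_mul_swap {F ι : Type*} [Field F]
    (qh : ParamMatrix F ι) {n : ℕ} (I : Fin (n + 1) → ι)
    (σ : Equiv.Perm (Fin (n + 1))) (i : Fin n) :
    muI qh I (σ * Equiv.swap i.castSucc i.succ)
      = qh.q (I (σ i.castSucc)) (I (σ i.succ)) * muI qh I σ := by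
  have hne : σ i.castSucc ≠ σ i.succ := by simp [Fin.ext_iff]
  rcases hne.lt_or_gt with h | h
  · exact muI_mul_swap_of_lt qh I σ i h
  · have := muI_mul_swap_of_lt qh I (σ * Equiv.swap i.castSucc i.succ) i (by simpa using h)
    simp only [Equiv.Perm.mul_apply, Equiv.swap_apply_left, Equiv.swap_apply_right,
      mul_assoc, Equiv.swap_mul_self, mul_one] at this
    rw [this, qh.q_symm (I (σ i.castSucc)), inv_mul_cancel_left₀ (qh.q_ne _ _)]

/-- A representation with `σ_a ↦ -P_q̂^{(a,a+1)}` sends the basis tensor `e_I` under `τ` to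
`(-1)^τ μ_I(q̂, τ⁻¹)` times the permuted basis tensor. -/
theorem rep_apply_single {F ι : Type*} [Field F] [Fintype ι] [DecidableEq ι]
    (qh : ParamMatrix F ι) {n : ℕ}
    (ρ : Equiv.Perm (Fin (n + 1)) →* (Module.End F ((Fin (n + 1) → ι) → F))ˣ)
    (hρ : ∀ i : Fin n,
      (ρ (Equiv.swap i.castSucc i.succ) : Module.End F ((Fin (n + 1) → ι) → F))
        = -liftAB (permOp qh) i.castSucc i.succ)
    (I : Fin (n + 1) → ι) (τ : Equiv.Perm (Fin (n + 1))) :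
    (ρ τ : Module.End F ((Fin (n + 1) → ι) → F)) (Pi.single I 1)
      = (((Equiv.Perm.sign τ : ℤ) : F) * muI qh I τ⁻¹) • Pi.single (I ∘ ⇑τ⁻¹) (1 : F) := by
  have hτ : τ ∈ Submonoid.closure
      (Set.range fun i : Fin n => Equiv.swap i.castSucc i.succ) := by
    rw [Equiv.Perm.mclosure_swap_castSucc_succ]
    trivial
  induction hτ using Submonoid.closure_induction_left with
  | one =>
    have hmu : muI qh I 1 = 1 := by
      refine Finset.prod_eq_one fun p hp => ?_
      simp only [Finset.mem_filter, inv_one, Equiv.Perm.one_apply] at hp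
      exact absurd hp.2.1 hp.2.2.not_gt
    simp [hmu]
  | mul_left s hs τ _ ih =>
    obtain ⟨i, rfl⟩ := hs
    have hne : i.castSucc ≠ i.succ := by simp [Fin.ext_iff]
    simp only [map_mul, Units.val_mul, Module.End.mul_apply, ih, map_smul, hρ,
      LinearMap.neg_apply, liftAB_permOp_single qh hne, mul_inv_rev, Equiv.swap_inv,
      muI_mul_swap, Equiv.Perm.sign_swap hne, Equiv.Perm.coe_mul, Function.comp_assoc,
      Function.comp_apply]
    rw [← neg_smul, smul_smul]
    congr 1
    push_cast
    ring

/-- let `ρ : S_k → GL(V^{⊗k})` be the homomorphism with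
`ρ(σ_a) = −P_q̂^{(a,a+1)}` for adjacent transpositions, and let
`A_{q̂,(k)} = (1/k!) ∑_σ ρ(σ)`.  For a tuple `I` of pairwise distinct indices and `σ ∈ S_k`,
the coefficient of `e_{i_{σ(1)}} ⊗ ⋯ ⊗ e_{i_{σ(k)}}` in `A_{q̂,(k)}(e_{i_1} ⊗ ⋯ ⊗ e_{i_k})`
equals `(1/k!) (−1)^σ μ_I(q̂, σ)`. -/
theorem A_operator_entry (qh : ParamMatrix K N) (k : ℕ) (hk : 1 ≤ k)
    (ρ : Equiv.Perm (Fin k) →* (Module.End K ((Fin k → N) → K))ˣ)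
    (hρ : ∀ (a : ℕ) (h : a + 1 < k),
      (ρ (Equiv.swap ⟨a, by omega⟩ ⟨a + 1, h⟩) : Module.End K ((Fin k → N) → K))
        = -liftAB (permOp qh) ⟨a, by omega⟩ ⟨a + 1, h⟩)
    (I : Fin k → N) (hI : Function.Injective I) (σ : Equiv.Perm (Fin k)) :
    (((k.factorial : K)⁻¹ •
        ∑ τ : Equiv.Perm (Fin k), (ρ τ : Module.End K ((Fin k → N) → K)))
      (Pi.single I 1)) (fun a => I (σ a))
      = (k.factorial : K)⁻¹ * ((Equiv.Perm.sign σ : ℤ) : K) * muI qh I σ := by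
  obtain ⟨n, rfl⟩ : ∃ n, k = n + 1 := ⟨k - 1, by omega⟩
  have hrep := rep_apply_single qh ρ (fun i => hρ i (by omega)) I
  simp only [LinearMap.smul_apply, LinearMap.sum_apply, Pi.smul_apply, Finset.sum_apply,
    smul_eq_mul, hrep, mul_assoc]
  congr 1
  rw [Finset.sum_eq_single σ⁻¹]
  · have hcomp : (fun a => I (σ a)) = I ∘ ⇑σ := rfl
    simp [hcomp]
  · intro τ _ hτ
    rw [Pi.single_eq_of_ne, mul_zero, mul_zero]
    intro h
    refine hτ (inv_eq_iff_eq_inv.mp (Equiv.ext fun x => hI ?_))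
    exact (congrFun h x).symm
  · simp
end
end
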